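/- For every positive integer n ≥ 2, n/φ(n) ≤ ∏_{p ≤ p_{ω(n)}} p/(p − 1), where ω(n) is the number of distinct prime divisors of n, p_{ω(n)} is the ω(n)-th prime, and the product runs over all primes p up to p_{ω(n)}. -/

import Mathlib

open Nat Real

/-- Two finite sets `s`, `t` of equal cardinality: if `f ≤ c` on `s \ t` and `c ≤ f` on `t \ s`,
then `∏ i ∈ s, f i ≤ ∏ i ∈ t, f i`. -/
lemma Finset.prod_le_prod_of_card_eq_of_threshold {ι : Type*} [DecidableEq ι] {s t : Finset ι}
    {f : ι → ℝ} {c : ℝ} (hcard : s.card = t.card) (hc : 0 ≤ c) (hs : ∀ i ∈ s, 0 ≤ f i)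
    (hst : ∀ i ∈ s \ t, f i ≤ c) (hts : ∀ i ∈ t \ s, c ≤ f i) :
    ∏ i ∈ s, f i ≤ ∏ i ∈ t, f i := by
  rw [← Finset.prod_inter_mul_prod_sdiff s t f, ← Finset.prod_inter_mul_prod_sdiff t s f,
    Finset.inter_comm t s]
  refine mul_le_mul_of_nonneg_left ?_
    (Finset.prod_nonneg fun i hi => hs i (Finset.mem_inter.mp hi).1)
  calc ∏ i ∈ s \ t, f i ≤ ∏ _i ∈ s \ t, c :=
        Finset.prod_le_prod (fun i hi => hs i (Finset.mem_sdiff.mp hi).1) hst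
    _ = ∏ _i ∈ t \ s, c := by
        rw [Finset.prod_const, Finset.prod_const, Finset.card_sdiff_comm hcard]
    _ ≤ ∏ i ∈ t \ s, f i := Finset.prod_le_prod (fun _ _ => hc) hts

lemma div_sub_one_le_div_sub_one {x y : ℝ} (hx : 1 < x) (hxy : x ≤ y) :
    y / (y - 1) ≤ x / (x - 1) := by
  rw [div_le_div_iff₀ (by linarith) (by linarith)]
  linarith

lemma Nat.div_totient_eq_prod_primeFactors {n : ℕ} (hn : n ≠ 0) :
    (n : ℝ) / φ n = ∏ p ∈ n.primeFactors, (p : ℝ) / (p - 1) := by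
  have hsub : ∀ p ∈ n.primeFactors, (p : ℝ) - 1 = ((p - 1 : ℕ) : ℝ) := fun p hp => by
    rw [Nat.cast_sub (Nat.prime_of_mem_primeFactors hp).one_le, Nat.cast_one]
  rw [Finset.prod_div_distrib, Finset.prod_congr rfl hsub, div_eq_div_iff]
  · rw [← Nat.cast_prod, ← Nat.cast_prod, ← Nat.cast_mul, ← Nat.cast_mul,
      ← Nat.totient_mul_prod_primeFactors, mul_comm]
  · exact_mod_cast (Nat.totient_pos.mpr (Nat.pos_of_ne_zero hn)).ne'
  · exact Finset.prod_ne_zero_iff.mpr fun p hp => Nat.cast_ne_zero.mpr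
      (Nat.sub_pos_of_lt (Nat.prime_of_mem_primeFactors hp).one_lt).ne'

lemma Nat.card_primesLE_nth_prime (k : ℕ) : (Nat.primesLE (Nat.nth Nat.Prime k)).card = k + 1 := by
  rw [Nat.primesLE_card_eq_primeCounting, Nat.primeCounting, Nat.primeCounting',
    Nat.count_nth_succ_of_infinite Nat.infinite_setOfPred_prime]

/-- For every positive integer `n ≥ 2`,
`n/φ(n) ≤ ∏_{p ≤ p_{ω(n)}} p/(p − 1)`, where `ω(n)` is the number of distinct prime
divisors of `n`, `p_{ω(n)}` is the `ω(n)`-th prime, and the product runs over all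
primes `p` up to `p_{ω(n)}`. -/
theorem totient_ratio_le_prod_primes (n : ℕ) (hn : 2 ≤ n) :
    (n : ℝ) / (Nat.totient n) ≤
      ∏ p ∈ (Finset.range (Nat.nth Nat.Prime (n.primeFactors.card - 1) + 1)).filter
          Nat.Prime, (p : ℝ) / (p - 1) := by
  have hpos : 0 < n.primeFactors.card :=
    Finset.card_pos.mpr (Nat.nonempty_primeFactors.mpr (by omega))
  rw [Nat.div_totient_eq_prod_primeFactors (by omega), ← Nat.primesLE_eq_filter_range]
  set N := Nat.nth Nat.Prime (n.primeFactors.card - 1) with hN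
  have hN1 : (1 : ℝ) < N := by exact_mod_cast (Nat.prime_nth_prime _).one_lt
  have hone : ∀ p : ℕ, p.Prime → (1 : ℝ) < p := fun p hp => by exact_mod_cast hp.one_lt
  refine Finset.prod_le_prod_of_card_eq_of_threshold (c := (N : ℝ) / (N - 1)) ?_
    (div_nonneg (by linarith) (by linarith)) (fun p hp => ?_) (fun p hp => ?_) (fun p hp => ?_)
  · rw [hN, Nat.card_primesLE_nth_prime]
    omega
  · have := hone p (Nat.prime_of_mem_primeFactors hp)
    exact div_nonneg (by linarith) (by linarith)
  · obtain ⟨hpn, hpN⟩ := Finset.mem_sdiff.mp hp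
    refine div_sub_one_le_div_sub_one hN1 (Nat.cast_le.mpr ?_)
    by_contra! h
    exact hpN (Nat.mem_primesLE.mpr ⟨h.le, Nat.prime_of_mem_primeFactors hpn⟩)
  · obtain ⟨hpN, hp⟩ := Nat.mem_primesLE.mp (Finset.mem_sdiff.mp hp).1
    exact div_sub_one_le_div_sub_one (hone p hp) (Nat.cast_le.mpr hpN)
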